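/- Let G be a graph and u a funnel vertex with out-neighbor x, i.e., N(u) \ {x} induces a clique. Then G has a minimum vertex cover C with u ∉ C or x ∉ C. -/

import Mathlib

open Finset

/-- `C` is a vertex cover of `G`. -/
def IsCover {V : Type*} (G : SimpleGraph V) (C : Finset V) : Prop :=
  ∀ u v, G.Adj u v → u ∈ C ∨ v ∈ C

/-- If `u` is a funnel with out-neighbor `x` (i.e. `N(u) \ {x}` induces a clique), then
`G` has a minimum vertex cover omitting `u` or omitting `x`. -/
theorem funnel_min_cover {V : Type*} [Fintype V] [DecidableEq V]
    (G : SimpleGraph V) [DecidableRel G.Adj] (u x : V)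
    (hux : G.Adj u x)
    (hclique : ∀ a ∈ (G.neighborFinset u).erase x, ∀ b ∈ (G.neighborFinset u).erase x,
      a ≠ b → G.Adj a b) :
    ∃ C : Finset V, IsCover G C ∧ (∀ C' : Finset V, IsCover G C' → C.card ≤ C'.card) ∧
      (u ∉ C ∨ x ∉ C) := by
  obtain ⟨C, hC, hmin⟩ := Set.exists_min_image {C : Finset V | IsCover G C} Finset.card
    (Set.toFinite _) ⟨Finset.univ, fun a _ _ => Or.inl (Finset.mem_univ a)⟩
  by_cases hu : u ∈ C
  swap
  · exact ⟨C, hC, hmin, Or.inl hu⟩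
  by_cases hx : x ∈ C
  swap
  · exact ⟨C, hC, hmin, Or.inr hx⟩
  -- It suffices to cover all neighbors of `u` by exchanging `u` for a single vertex.
  obtain ⟨v, hvu, hv⟩ : ∃ v, v ≠ u ∧ ∀ b, G.Adj u b → b = v ∨ b ∈ C := by
    by_cases h : ∃ v, G.Adj u v ∧ v ∉ C
    · obtain ⟨v, huv, hvC⟩ := h
      refine ⟨v, huv.ne', fun b hb => ?_⟩
      by_cases hbv : b = v
      · exact Or.inl hbv
      by_cases hbx : b = x
      · exact Or.inr (hbx ▸ hx)
      have hvx : v ≠ x := fun e => hvC (e ▸ hx)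
      have hbv_adj := hclique b (by simp [hbx, hb]) v (by simp [hvx, huv]) hbv
      exact Or.inr ((hC b v hbv_adj).resolve_right hvC)
    · push Not at h
      exact ⟨x, hux.ne', fun b hb => Or.inr (h b hb)⟩
  refine ⟨insert v (C.erase u), fun a b hab => ?_, fun C' hC' => ?_, Or.inl (by simp [hvu.symm])⟩
  · have hne := hab.ne
    have hCab := hC a b hab
    have hva := hv a
    have hvb := hv b
    have hba := hab.symm
    simp only [Finset.mem_insert, Finset.mem_erase]
    grind
  · calc (insert v (C.erase u)).card ≤ (C.erase u).card + 1 := Finset.card_insert_le _ _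
      _ = C.card := Finset.card_erase_add_one hu
      _ ≤ C'.card := hmin C' hC'
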